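/- arXiv:1809.10068 — 2 statements merged into one kernel-verified Lean document; each statement's English description precedes it below -/
import Mathlib

section
/- Discrete-time non-oscillation principle (eventually competitive case): Let T : ℝ^N → ℝ^N be a bijection and suppose T is eventually competitive, i.e. there exists an integer n* ≥ 1 such that for every n ≥ n*, Tⁿx < Tⁿy implies x < y. Then for every point z, the full orbit {Tᵐ z : m ∈ ℤ} cannot have both an increasing segment and a decreasing segment; that is, there do not exist integers m < n and k < l with Tᵐ z < Tⁿ z and Tᵏ z > Tˡ z (where Tᵐ for m ∈ ℤ denotes the m-th iterate of T, using the inverse for negative m). -/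
open Filter Topology

variable {N : ℕ}

/-- `x ≤ y` in the partial order induced by the cone `C`: `y - x ∈ C`. -/
def coneLE (C : Set (EuclideanSpace ℝ (Fin N))) (x y : EuclideanSpace ℝ (Fin N)) : Prop :=
  y - x ∈ C

/-- `x < y` in the partial order induced by the cone `C`: `y - x ∈ C \ {0}`. -/
def coneLT (C : Set (EuclideanSpace ℝ (Fin N))) (x y : EuclideanSpace ℝ (Fin N)) : Prop :=
  y - x ∈ C \ {0}

/-- `x ≪ y` in the partial order induced by the cone `C`: `y - x ∈ interior C`. -/
def coneLLT (C : Set (EuclideanSpace ℝ (Fin N))) (x y : EuclideanSpace ℝ (Fin N)) : Prop :=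
  y - x ∈ interior C

/-- `C` is a closed convex cone that is salient: `C ∩ (-C) = {0}`. -/
def IsClosedSalientConvexCone (C : Set (EuclideanSpace ℝ (Fin N))) : Prop :=
  IsClosed C ∧ (∀ x ∈ C, ∀ y ∈ C, x + y ∈ C) ∧
    (∀ (a : ℝ), 0 ≤ a → ∀ x ∈ C, a • x ∈ C) ∧ C ∩ (-C) = {0}

/-- `φ` is a continuous flow on `ℝ^N`. -/
def IsFlow (φ : ℝ → EuclideanSpace ℝ (Fin N) → EuclideanSpace ℝ (Fin N)) : Prop :=
  (∀ t : ℝ, Continuous (φ t)) ∧ (φ 0 = id) ∧ (∀ s t : ℝ, φ (s + t) = φ s ∘ φ t)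

/-- `φ` is eventually cooperative with transient `tstar`:
it preserves the cone order in forward time after time `tstar`. -/
def EventuallyCooperative (C : Set (EuclideanSpace ℝ (Fin N)))
    (φ : ℝ → EuclideanSpace ℝ (Fin N) → EuclideanSpace ℝ (Fin N)) (tstar : ℝ) : Prop :=
  ∀ x y, coneLE C x y → ∀ t : ℝ, tstar ≤ t → coneLE C (φ t x) (φ t y)

/-- `φ` is eventually competitive with transient `tstar`:
it preserves the cone order in backward time after time `tstar`. -/
def EventuallyCompetitive (C : Set (EuclideanSpace ℝ (Fin N)))
    (φ : ℝ → EuclideanSpace ℝ (Fin N) → EuclideanSpace ℝ (Fin N)) (tstar : ℝ) : Prop :=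
  ∀ x y, coneLE C x y → ∀ t : ℝ, t ≤ -tstar → coneLE C (φ t x) (φ t y)

/-- The ω-limit set of `x`: all limits of sequences `φ_{t_k} x` with `t_k → +∞`. -/
def omegaLimitSet (φ : ℝ → EuclideanSpace ℝ (Fin N) → EuclideanSpace ℝ (Fin N))
    (x : EuclideanSpace ℝ (Fin N)) : Set (EuclideanSpace ℝ (Fin N)) :=
  {y | ∃ tk : ℕ → ℝ, Tendsto tk atTop atTop ∧ Tendsto (fun k => φ (tk k) x) atTop (𝓝 y)}

/-- The α-limit set of `x`: all limits of sequences `φ_{t_k} x` with `t_k → -∞`. -/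
def alphaLimitSet (φ : ℝ → EuclideanSpace ℝ (Fin N) → EuclideanSpace ℝ (Fin N))
    (x : EuclideanSpace ℝ (Fin N)) : Set (EuclideanSpace ℝ (Fin N)) :=
  {y | ∃ tk : ℕ → ℝ, Tendsto tk atTop atBot ∧ Tendsto (fun k => φ (tk k) x) atTop (𝓝 y)}

/-- The strict cone order of a closed salient convex cone is transitive. -/
theorem coneLT_trans {C : Set (EuclideanSpace ℝ (Fin N))} (hC : IsClosedSalientConvexCone C)
    {x y w : EuclideanSpace ℝ (Fin N)} (hxy : coneLT C x y) (hyw : coneLT C y w) :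
    coneLT C x w := by
  obtain ⟨-, hadd, -, hsal⟩ := hC
  have hsum : w - x = (y - x) + (w - y) := by abel
  refine ⟨hsum ▸ hadd _ hxy.1 _ hyw.1, fun h0 => hxy.2 ?_⟩
  have hneg : -(y - x) = w - y := by
    rw [Set.mem_singleton_iff, hsum] at h0
    exact neg_eq_of_add_eq_zero_right h0
  rw [← hsal]
  exact ⟨hxy.1, Set.mem_neg.2 (hneg ▸ hyw.1)⟩

theorem not_coneLT_self (C : Set (EuclideanSpace ℝ (Fin N))) (x : EuclideanSpace ℝ (Fin N)) :
    ¬ coneLT C x x := fun h => h.2 (sub_self x)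

/-- If `T` is eventually competitive, an ordered pair of orbit points stays ordered under every
backward time shift past the transient. -/
theorem coneLT_orbit_sub {C : Set (EuclideanSpace ℝ (Fin N))}
    {T : Equiv.Perm (EuclideanSpace ℝ (Fin N))} {nstar : ℤ}
    (hcomp : ∀ n : ℤ, nstar ≤ n → ∀ x y : EuclideanSpace ℝ (Fin N),
        coneLT C ((T ^ n) x) ((T ^ n) y) → coneLT C x y)
    {z : EuclideanSpace ℝ (Fin N)} {m n s : ℤ} (hs : nstar ≤ s)
    (h : coneLT C ((T ^ m) z) ((T ^ n) z)) :
    coneLT C ((T ^ (m - s)) z) ((T ^ (n - s)) z) := by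
  apply hcomp s hs
  simpa only [← Equiv.Perm.mul_apply, ← zpow_add, add_sub_cancel] using h

/-- A transitive relation relating `a i` to `a (i + p)` for all `i ≤ M` relates `a i` to
`a (i + (j + 1) * p)` as long as the intermediate indices do not exceed `M`. -/
theorem rel_add_mul_of_rel_add {α : Type*} {r : α → α → Prop}
    (htrans : ∀ x y w, r x y → r y w → r x w) {a : ℤ → α} {p M : ℤ} (hp : 0 < p)
    (hstep : ∀ i ≤ M, r (a i) (a (i + p))) {i : ℤ} (j : ℕ) (hi : i + j * p ≤ M) :
    r (a i) (a (i + (j + 1) * p)) := by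
  induction j with
  | zero => simpa using hstep i (by simpa using hi)
  | succ j ih =>
    push_cast at hi ⊢
    have hlast := hstep (i + (j + 1) * p) hi
    rw [show i + (j + 1) * p + p = i + ((j : ℤ) + 1 + 1) * p by ring] at hlast
    exact htrans _ _ _ (ih (by linarith)) hlast

theorem discrete_nonoscillation_eventually_competitive
    (C : Set (EuclideanSpace ℝ (Fin N))) (hC : IsClosedSalientConvexCone C)
    (T : Equiv.Perm (EuclideanSpace ℝ (Fin N)))
    (nstar : ℤ) (hnstar : 1 ≤ nstar)
    (hcomp : ∀ n : ℤ, nstar ≤ n → ∀ x y : EuclideanSpace ℝ (Fin N),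
        coneLT C ((T ^ n) x) ((T ^ n) y) → coneLT C x y)
    (z : EuclideanSpace ℝ (Fin N)) :
    ¬ ∃ m n k l : ℤ, m < n ∧ k < l ∧
        coneLT C ((T ^ m) z) ((T ^ n) z) ∧ coneLT C ((T ^ l) z) ((T ^ k) z) := by
  rintro ⟨m, n, k, l, hmn, hkl, hinc, hdec⟩
  obtain ⟨p, rfl⟩ : ∃ p : ℕ, n = m + (p + 1) := ⟨(n - m - 1).toNat, by omega⟩
  obtain ⟨q, rfl⟩ : ∃ q : ℕ, l = k + (q + 1) := ⟨(l - k - 1).toNat, by omega⟩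
  have hup : ∀ i ≤ m - nstar, coneLT C ((T ^ i) z) ((T ^ (i + (p + 1))) z) := fun i hi => by
    have h := coneLT_orbit_sub hcomp (s := m - i) (by omega) hinc
    rwa [sub_sub_cancel, show m + (p + 1) - (m - i) = i + ((p : ℤ) + 1) by ring] at h
  have hdown : ∀ i ≤ k - nstar, coneLT C ((T ^ (i + (q + 1))) z) ((T ^ i) z) := fun i hi => by
    have h := coneLT_orbit_sub hcomp (s := k - i) (by omega) hdec
    rwa [sub_sub_cancel, show k + (q + 1) - (k - i) = i + ((q : ℤ) + 1) by ring] at h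
  let M := min (m - nstar) (k - nstar)
  let i := M - (p + 1) * (q + 1)
  have hM₁ : M ≤ m - nstar := min_le_left _ _
  have hM₂ : M ≤ k - nstar := min_le_right _ _
  have hrise := rel_add_mul_of_rel_add (r := coneLT C) (a := fun i => (T ^ i) z)
    (fun _ _ _ => coneLT_trans hC) (by positivity) hup (i := i) q (by grind)
  have hfall := rel_add_mul_of_rel_add (r := fun x y => coneLT C y x) (a := fun i => (T ^ i) z)
    (fun _ _ _ hxy hyw => coneLT_trans hC hyw hxy) (by positivity) hdown (i := i) p (by grind)
  rw [mul_comm] at hfall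
  exact not_coneLT_self C _ (coneLT_trans hC hrise hfall)
end

section
/- Strong order-domination of a periodic orbit by an equilibrium (intermediate claim in the proof of the structural stability theorem): Let φ be a continuous flow on ℝ^N that is eventually competitive with transient t* ≥ 0, where the order comes from a closed salient convex cone C with nonempty interior. Let p be an equilibrium point (φ_t p = p for all t ∈ ℝ), and let x be a periodic point with period T > 0 such that x ≪ p. Then the entire orbit of x lies strictly below p: φ_s x ≪ p for every s ∈ ℝ. -/
open Filter Topology

variable {N : ℕ}

/-- After the transient, an eventually competitive flow preserves the relation of lying strongly
below a point fixed by it. -/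
theorem EventuallyCompetitive.coneLLT_of_le
    {C : Set (EuclideanSpace ℝ (Fin N))}
    {φ : ℝ → EuclideanSpace ℝ (Fin N) → EuclideanSpace ℝ (Fin N)} {tstar : ℝ}
    (hcomp : EventuallyCompetitive C φ tstar) (hφ : IsFlow φ)
    {x p : EuclideanSpace ℝ (Fin N)} {t : ℝ} (ht : t ≤ -tstar) (hp : φ t p = p)
    (hxp : coneLLT C x p) : coneLLT C (φ t x) p := by
  obtain ⟨hcont, hzero, hadd⟩ := hφ
  have hleft : φ (-t) (φ t x) = x := by
    rw [← Function.comp_apply (f := φ (-t)), ← hadd, neg_add_cancel, hzero, id]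
  have hright (z) : φ t (φ (-t) z) = z := by
    rw [← Function.comp_apply (f := φ t), ← hadd, add_neg_cancel, hzero, id]
  have hopen : IsOpen {w | p - φ (-t) (p - w) ∈ interior C} :=
    isOpen_interior.preimage
      (continuous_const.sub ((hcont (-t)).comp (continuous_const.sub continuous_id)))
  refine interior_maximal (fun w hw => ?_) hopen ?_
  · have h := hcomp _ _ (interior_subset hw : coneLE C (φ (-t) (p - w)) p) t ht
    rwa [hright, hp, coneLE, sub_sub_cancel] at h
  · rwa [Set.mem_ofPred_eq, sub_sub_cancel, hleft]

/-- A period of a point under a flow may be iterated backwards. -/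
theorem IsFlow.sub_nat_mul_period
    {φ : ℝ → EuclideanSpace ℝ (Fin N) → EuclideanSpace ℝ (Fin N)} (hφ : IsFlow φ)
    {x : EuclideanSpace ℝ (Fin N)} {T : ℝ} (hx : φ T x = x) (s : ℝ) (n : ℕ) :
    φ (s - n * T) x = φ s x := by
  induction n with
  | zero => simp
  | succ n ih =>
    rw [← ih, show s - n * T = (s - (n + 1 : ℕ) * T) + T by push_cast; ring, hφ.2.2,
      Function.comp_apply, hx]

theorem periodic_orbit_strongly_below_equilibrium
    (C : Set (EuclideanSpace ℝ (Fin N))) (hC : IsClosedSalientConvexCone C)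
    (hint : (interior C).Nonempty)
    (φ : ℝ → EuclideanSpace ℝ (Fin N) → EuclideanSpace ℝ (Fin N)) (hφ : IsFlow φ)
    (tstar : ℝ) (htstar : 0 ≤ tstar)
    (hcomp : EventuallyCompetitive C φ tstar)
    (p : EuclideanSpace ℝ (Fin N)) (hp : ∀ t : ℝ, φ t p = p)
    (x : EuclideanSpace ℝ (Fin N)) (T : ℝ) (hT : 0 < T) (hx : φ T x = x)
    (hxp : coneLLT C x p) :
    ∀ s : ℝ, coneLLT C (φ s x) p := by
  intro s
  obtain ⟨n, hn⟩ := exists_nat_ge ((s + tstar) / T)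
  rw [div_le_iff₀ hT] at hn
  rw [← hφ.sub_nat_mul_period hx s n]
  exact hcomp.coneLLT_of_le hφ (by linarith) (hp _) hxp
end
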